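/- Let q ≥ n be a prime power, and let g, r, h, a be positive integers with n = g·r, t = a + ⌈h/g⌉ ≤ r, and m = h + g·a − t. Then there exists an (n,r,h,a,g) maximally recoverable LRC over the field F_{q^m}; in particular MR-LRCs exist over fields of size O(n)^{h + (g−1)a − ⌈h/g⌉}. -/

import Mathlib

/-- A polynomial with pairwise distinct exponents that vanishes at more points than its degree has
zero coefficients. -/
lemma eq_zero_of_forall_sum_mul_pow_eq_zero {K ι κ : Type*} [Field K] [Fintype ι] [Fintype κ]
    {x : ι → K} (hx : Function.Injective x) {e : κ → ℕ} (he : Function.Injective e)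
    (hlt : ∀ k, e k < Fintype.card ι) {c : κ → K} (h : ∀ j, ∑ k, c k * x j ^ e k = 0) :
    c = 0 := by
  classical
  rcases isEmpty_or_nonempty κ with hκ | ⟨⟨k₀⟩⟩
  · exact Subsingleton.elim _ _
  have hp : (∑ k, Polynomial.monomial (e k) (c k)) = 0 := by
    refine Polynomial.eq_zero_of_natDegree_lt_card_of_eval_eq_zero _ hx (fun j => ?_) ?_
    · simpa [Polynomial.eval_finsetSum] using h j
    · have := hlt k₀
      refine lt_of_le_of_lt (Polynomial.natDegree_sum_le_of_forall_le (n := Fintype.card ι - 1)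
        _ _ fun k _ => ?_) (by omega)
      exact (Polynomial.natDegree_monomial_le _).trans (by have := hlt k; omega)
  funext k
  have := congrArg (fun p => Polynomial.coeff p (e k)) hp
  simpa [Polynomial.finsetSum_coeff, Polynomial.coeff_monomial, he.eq_iff] using this

/-- A family of vectors, as many as there are coordinates, is linearly independent as soon as no
nonzero functional vanishes on it. -/
lemma linearIndependent_of_forall_sum_mul_eq_zero {K ι κ : Type*} [Field K] [Fintype ι]
    [Fintype κ] {f : κ → ι → K} (hcard : Fintype.card κ = Fintype.card ι)
    (h : ∀ v : ι → K, (∀ k, ∑ i, v i * f k i = 0) → v = 0) : LinearIndependent K f := by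
  classical
  let e : ι ≃ κ := Fintype.equivOfCardEq hcard.symm
  rw [← linearIndependent_equiv e]
  let M : Matrix ι ι K := Matrix.of (f ∘ e)
  change LinearIndependent K M.row
  rw [Matrix.linearIndependent_rows_iff_isUnit, ← Matrix.mulVec_injective_iff_isUnit,
    ← Matrix.coe_mulVecLin, ← LinearMap.ker_eq_bot, LinearMap.ker_eq_bot']
  intro v hv
  refine h v fun k => ?_
  have := congrFun hv (e.symm k)
  simpa [M, Matrix.mulVec, dotProduct, mul_comm] using this

/-- A vector orthogonal to all powers of pairwise distinct points is zero. -/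
lemma eq_zero_of_forall_sum_mul_pow_lt_card {K ι : Type*} [Field K] [Fintype ι]
    {x w : ι → K} (hx : Function.Injective x)
    (h : ∀ s < Fintype.card ι, ∑ j, w j * x j ^ s = 0) : w = 0 := by
  let e := Fintype.equivFin ι
  have := Matrix.eq_zero_of_forall_pow_sum_mul_pow_eq_zero (f := x ∘ e.symm) (v := w ∘ e.symm)
    (hx.comp e.symm.injective) fun i => by
      rw [← h i i.2]
      exact e.symm.sum_comp fun j => w j * x j ^ (i : ℕ)
  funext j
  simpa using congrFun this (e j)

/-- A `q`-linearized polynomial of `q`-degree less than `N` vanishing on the image of an injective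
linear map from a space of dimension at least `N` is zero. -/
lemma eq_zero_of_forall_sum_mul_frobenius_eq_zero {F K V : Type*} [Field F] [Fintype F] [Field K]
    [Algebra F K] [AddCommGroup V] [Module F V] [Module.Finite F V] {N : ℕ}
    (hN : N ≤ Module.finrank F V) {γ : V →ₗ[F] K} (hγ : Function.Injective γ) {d : Fin N → K}
    (h : ∀ v, ∑ l, d l * γ v ^ Fintype.card F ^ (l : ℕ) = 0) : d = 0 := by
  have : Finite V := Module.finite_of_finite F
  have := Fintype.ofFinite V
  refine eq_zero_of_forall_sum_mul_pow_eq_zero hγ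
    ((Nat.pow_right_injective (Fintype.one_lt_card (α := F))).comp Fin.val_injective) (fun l => ?_) h
  rw [Module.card_eq_pow_finrank (K := F) (V := V)]
  exact Nat.pow_lt_pow_right Fintype.one_lt_card (l.2.trans_le hN)

/-- The erasure-correction property of the code with Vandermonde local parities, `c` Vandermonde
global parities and `N` Moore-type global parities. -/
lemma linearIndependent_vandermonde_moore_columns {F K ι G : Type*} [Field F] [Fintype F] [Field K]
    [Algebra F K] [FiniteDimensional F K] [Fintype ι] [Fintype G] [DecidableEq G] {a c N : ℕ}
    (grp : ι → G) {x : ι → F} (hx : Function.Injective x)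
    (hcard : Fintype.card ι = Fintype.card G * a + (c + N))
    (hm : Fintype.card ι ≤ a + c + Module.finrank F K)
    (hE : ∀ i, a ≤ Fintype.card {p // grp p = i})
    (hbig : ∃ i, a + c ≤ Fintype.card {p // grp p = i}) :
    LinearIndependent K (fun p : ι =>
      Sum.elim
        (fun ik : G × Fin a => if ik.1 = grp p then algebraMap F K (x p) ^ (ik.2 : ℕ) else 0)
        (Fin.addCases (motive := fun _ => K)
          (fun l : Fin c => algebraMap F K (x p) ^ (a + l : ℕ))
          (fun l : Fin N =>
            (∑ s : Fin (Module.finrank F K),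
              (x p ^ (a + c + s : ℕ)) • Module.finBasis F K s) ^ Fintype.card F ^ (l : ℕ)))) := by
  classical
  let b := Module.finBasis F K
  let β : ι → K := fun p => ∑ s : Fin (Module.finrank F K), (x p ^ (a + c + s : ℕ)) • b s
  have hX : Function.Injective fun p => algebraMap F K (x p) :=
    (algebraMap F K).injective.comp hx
  refine linearIndependent_of_forall_sum_mul_eq_zero (by simp [hcard]) fun v hv => ?_
  have hv' : ∀ p, ∑ k : Fin a, v (.inl (grp p, k)) * algebraMap F K (x p) ^ (k : ℕ) +
      (∑ l : Fin c, v (.inr (Fin.castAdd N l)) * algebraMap F K (x p) ^ (a + l : ℕ) +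
      ∑ l : Fin N, v (.inr (Fin.natAdd c l)) * β p ^ Fintype.card F ^ (l : ℕ)) = 0 := by
    intro p
    have := hv p
    rw [Fintype.sum_sum_type, Fintype.sum_prod_type, Fin.sum_univ_add] at this
    simp only [Sum.elim_inl, Sum.elim_inr, Fin.addCases_left, Fin.addCases_right] at this
    rw [← this]
    congr 1
    rw [Finset.sum_eq_single (grp p)]
    · simp
    · intro i _ hi
      simp [hi]
    · simp
  let T : (ι → F) →ₗ[F] (G × Fin a ⊕ Fin c → F) := Matrix.mulVecLin (Matrix.of fun i p =>
    Sum.elim (fun ik : G × Fin a => if grp p = ik.1 then x p ^ (ik.2 : ℕ) else 0)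
      (fun l : Fin c => x p ^ (a + l : ℕ)) i)
  let γ : (ι → F) →ₗ[F] K := Fintype.linearCombination F β
  have hγ (w : ι → F) : γ w = ∑ p, w p • β p := Fintype.linearCombination_apply ..
  have hloc (w : ι → F) (hw : T w = 0) (i : G) (k : Fin a) :
      ∑ p, (if grp p = i then w p * x p ^ (k : ℕ) else 0) = 0 := by
    have := congrFun hw (.inl (i, k))
    simpa [T, Matrix.mulVec, dotProduct, mul_comm] using this
  have hmid (w : ι → F) (hw : T w = 0) (l : Fin c) : ∑ p, w p * x p ^ (a + l : ℕ) = 0 := by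
    have := congrFun hw (.inr l)
    simpa [T, Matrix.mulVec, dotProduct, mul_comm] using this
  have hrank : N ≤ Module.finrank F (LinearMap.ker T) := by
    have h1 := T.finrank_range_add_finrank_ker
    have h2 := Submodule.finrank_le (LinearMap.range T)
    simp only [Module.finrank_fintype_fun_eq_card, Fintype.card_sum, Fintype.card_prod,
      Fintype.card_fin] at h1 h2
    omega
  have hlocw (w : ι → F) (hw : T w = 0) (k : Fin a) : ∑ p, w p * x p ^ (k : ℕ) = 0 := by
    have : ∑ i, ∑ p, (if grp p = i then w p * x p ^ (k : ℕ) else 0) = 0 :=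
      Finset.sum_eq_zero fun i _ => hloc w hw i k
    rw [Finset.sum_comm] at this
    simpa using this
  have hinj : Function.Injective (γ ∘ₗ (LinearMap.ker T).subtype) := by
    rw [← LinearMap.ker_eq_bot, LinearMap.ker_eq_bot']
    rintro ⟨w, hw⟩ hγw
    rw [LinearMap.mem_ker] at hw
    have hγw' : ∑ s : Fin (Module.finrank F K), (∑ p, w p * x p ^ (a + c + s : ℕ)) • b s = 0 := by
      rw [← hγw]
      simp only [LinearMap.comp_apply, Submodule.subtype_apply, hγ, β, Finset.sum_smul,
        Finset.smul_sum, smul_smul]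
      exact Finset.sum_comm
    have htop := Fintype.linearIndependent_iff.1 b.linearIndependent _ hγw'
    ext1
    refine eq_zero_of_forall_sum_mul_pow_lt_card hx fun s hs => ?_
    rcases lt_or_ge s a with hsa | hsa
    · exact hlocw w hw ⟨s, hsa⟩
    rcases lt_or_ge s (a + c) with hsc | hsc
    · simpa [Nat.add_sub_cancel' hsa] using hmid w hw ⟨s - a, by omega⟩
    · simpa [Nat.add_sub_cancel' hsc] using htop ⟨s - (a + c), by omega⟩
  have hd : (fun l : Fin N => v (.inr (Fin.natAdd c l))) = 0 := by
    refine eq_zero_of_forall_sum_mul_frobenius_eq_zero hrank hinj ?_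
    rintro ⟨w, hw⟩
    rw [LinearMap.mem_ker] at hw
    have hfrob (l : ℕ) : γ w ^ Fintype.card F ^ l =
        ∑ p, w p • β p ^ Fintype.card F ^ l := by
      have hφ (y : K) : (FiniteField.frobeniusAlgHom F K ^ l) y = y ^ Fintype.card F ^ l := by
        rw [AlgHom.coe_pow, FiniteField.coe_frobeniusAlgHom, pow_iterate]
      rw [← hφ, hγ, map_sum]
      simp_rw [map_smul, hφ]
    simp only [LinearMap.comp_apply, Submodule.subtype_apply, hfrob, Finset.mul_sum]
    rw [Finset.sum_comm]
    have hrow (p : ι) : ∑ l : Fin N, v (.inr (Fin.natAdd c l)) *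
        (w p • β p ^ Fintype.card F ^ (l : ℕ)) =
        -(∑ k : Fin a, v (.inl (grp p, k)) * algebraMap F K (w p * x p ^ (k : ℕ)) +
        ∑ l : Fin c, v (.inr (Fin.castAdd N l)) * algebraMap F K (w p * x p ^ (a + l : ℕ))) := by
      have := congrArg (algebraMap F K (w p) * ·) (hv' p)
      simp only [mul_add, Finset.mul_sum, mul_zero] at this
      rw [eq_neg_iff_add_eq_zero, ← this, ← add_assoc, add_comm]
      simp only [Algebra.smul_def, map_mul, map_pow, mul_left_comm]
      ring
    simp_rw [hrow]
    rw [Finset.sum_neg_distrib, neg_eq_zero, Finset.sum_add_distrib]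
    have h1 : ∑ p, ∑ k : Fin a, v (.inl (grp p, k)) *
        algebraMap F K (w p * x p ^ (k : ℕ)) = 0 := by
      have hterm (p : ι) (k : Fin a) :
          v (.inl (grp p, k)) * algebraMap F K (w p * x p ^ (k : ℕ)) =
          ∑ i, v (.inl (i, k)) *
            algebraMap F K (if grp p = i then w p * x p ^ (k : ℕ) else 0) := by
        rw [Finset.sum_eq_single (grp p)]
        · simp
        · intro i _ hi
          simp [hi.symm]
        · simp
      rw [Finset.sum_comm]
      refine Finset.sum_eq_zero fun k _ => ?_
      simp_rw [hterm]
      rw [Finset.sum_comm]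
      refine Finset.sum_eq_zero fun i _ => ?_
      rw [← Finset.mul_sum, ← map_sum, hloc w hw, map_zero, mul_zero]
    have h2 : ∑ p, ∑ l : Fin c, v (.inr (Fin.castAdd N l)) *
        algebraMap F K (w p * x p ^ (a + l : ℕ)) = 0 := by
      rw [Finset.sum_comm]
      refine Finset.sum_eq_zero fun l _ => ?_
      rw [← Finset.mul_sum, ← map_sum, hmid w hw, map_zero, mul_zero]
    rw [h1, h2, add_zero]
  have hd' (l : Fin N) : v (.inr (Fin.natAdd c l)) = 0 := congrFun hd l
  simp only [hd', zero_mul, Finset.sum_const_zero, add_zero] at hv'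
  have hmid0 : ∀ l : Fin c, v (.inr (Fin.castAdd N l)) = 0 := by
    obtain ⟨i, hi⟩ := hbig
    have := eq_zero_of_forall_sum_mul_pow_eq_zero
      (x := fun p : {p // grp p = i} => algebraMap F K (x p)) (e := fun k : Fin (a + c) => (k : ℕ))
      (c := Fin.addCases (motive := fun _ => K) (fun k => v (.inl (i, k)))
        (fun l => v (.inr (Fin.castAdd N l))))
      (hX.comp Subtype.val_injective) Fin.val_injective (fun k => k.2.trans_le hi) fun p => by
        have := hv' p
        rw [p.2] at this
        simpa [Fin.sum_univ_add] using this
    intro l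
    simpa using congrFun this (Fin.natAdd a l)
  simp only [hmid0, zero_mul, Finset.sum_const_zero, add_zero] at hv'
  have hloc0 (i : G) : (fun k : Fin a => v (.inl (i, k))) = 0 :=
    eq_zero_of_forall_sum_mul_pow_eq_zero
      (x := fun p : {p // grp p = i} => algebraMap F K (x p))
      (hX.comp Subtype.val_injective) Fin.val_injective (fun k => k.2.trans_le (hE i)) fun p => by
        have := hv' p
        rwa [p.2] at this
  funext j
  rcases j with ⟨i, k⟩ | l
  · exact congrFun (hloc0 i) k
  · exact Fin.addCases (motive := fun l => v (.inr l) = 0) hmid0 hd' l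

/-- A finite field with `q ^ m` elements, `m ≠ 0`, has degree `m` over a field with `q` elements. -/
lemma exists_algebra_card_eq_of_card_eq_pow {K : Type*} [Field K] [Fintype K] {q m : ℕ}
    (hq : IsPrimePow q) (hK : Fintype.card K = q ^ m) :
    ∃ (F : Type) (_ : Field F) (_ : Fintype F) (_ : Algebra F K),
      Fintype.card F = q ∧ Module.finrank F K = m := by
  obtain ⟨p, e, hp, he, rfl⟩ := hq
  have : Fact p.Prime := ⟨hp.nat_prime⟩
  rw [← pow_mul] at hK
  have : CharP K p := charP_of_card_eq_prime_pow hK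
  let := ZMod.algebra K p
  have : Fintype (GaloisField p e) := Fintype.ofFinite _
  have hF : Fintype.card (GaloisField p e) = p ^ e := by
    rw [← Nat.card_eq_fintype_card, GaloisField.card p e he.ne']
  have hKrank : Module.finrank (ZMod p) K = e * m := by
    apply Nat.pow_right_injective hp.nat_prime.two_le
    change p ^ _ = p ^ _
    rw [← hK, Module.card_eq_pow_finrank (K := ZMod p) (V := K), ZMod.card]
  obtain ⟨f⟩ := FiniteField.nonempty_algHom_of_finrank_dvd (F := ZMod p) (K := GaloisField p e)
    (L := K) (by rw [GaloisField.finrank p he.ne', hKrank]; exact Dvd.intro _ rfl)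
  let := f.toRingHom.toAlgebra
  refine ⟨GaloisField p e, inferInstance, inferInstance, inferInstance, hF, ?_⟩
  apply Nat.pow_right_injective (hF ▸ Fintype.one_lt_card : 1 < p ^ e)
  change (p ^ e) ^ _ = (p ^ e) ^ _
  rw [← pow_mul p e m, ← hK, Module.card_eq_pow_finrank (K := GaloisField p e) (V := K), hF]


theorem exists_mr_lrc_small_groups (q g r h a n : ℕ) (hq : IsPrimePow q) (hqn : n ≤ q)
    (hg : 0 < g) (hr : 0 < r) (hh : 0 < h) (ha : 0 < a) (hn : n = g * r)
    (ht : a + (h + g - 1) / g ≤ r)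
    (K : Type*) [Field K] [Fintype K]
    (hK : Fintype.card K = q ^ (h + g * a - (a + (h + g - 1) / g))) :
    ∃ (A : Fin g → Matrix (Fin a) (Fin r) K) (B : Fin g → Matrix (Fin h) (Fin r) K),
      -- each local parity check matrix is MDS: any a columns are linearly independent
      (∀ (i : Fin g) (s : Fin a → Fin r), Function.Injective s →
        LinearIndependent K (fun j : Fin a => fun k : Fin a => A i k (s j))) ∧
      -- every erasure pattern with a erasures per group plus h more gives
      -- linearly independent columns of the parity check matrix H
      (∀ E : Finset (Fin g × Fin r), E.card = g * a + h →
        (∀ i : Fin g, a ≤ (E.filter (fun p => p.1 = i)).card) →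
        LinearIndependent K (fun p : E =>
          Sum.elim
            (fun ik : Fin g × Fin a =>
              if ik.1 = (p : Fin g × Fin r).1 then A ik.1 ik.2 (p : Fin g × Fin r).2 else 0)
            (fun l : Fin h => B (p : Fin g × Fin r).1 l (p : Fin g × Fin r).2))) := by
  obtain ⟨F, _, _, _, hF, hrank⟩ := exists_algebra_card_eq_of_card_eq_pow hq hK
  obtain ⟨x⟩ : Nonempty (Fin g × Fin r ↪ F) :=
    Function.Embedding.nonempty_of_card_le (by simpa [hF, ← hn] using hqn)
  have hch : (h + g - 1) / g ≤ h := by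
    rw [Nat.div_le_iff_le_mul_add_pred hg]
    have := Nat.le_mul_of_pos_left h hg
    omega
  have hgc : g * ((h + g - 1) / g) ≤ h + g - 1 := Nat.mul_div_le _ _
  generalize (h + g - 1) / g = c at *
  obtain ⟨N, rfl⟩ := Nat.exists_eq_add_of_le hch
  refine ⟨fun i => Matrix.of fun k j => algebraMap F K (x (i, j)) ^ (k : ℕ),
    fun i => Matrix.of fun l j => Fin.addCases (motive := fun _ => K)
      (fun l : Fin c => algebraMap F K (x (i, j)) ^ (a + l : ℕ))
      (fun l : Fin N => (∑ s : Fin (Module.finrank F K),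
        (x (i, j) ^ (a + c + s : ℕ)) • Module.finBasis F K s) ^ Fintype.card F ^ (l : ℕ)) l,
    fun i s hs => ?_, fun E hE hloc => ?_⟩
  · refine linearIndependent_of_forall_sum_mul_eq_zero rfl fun v hv => ?_
    refine eq_zero_of_forall_sum_mul_pow_eq_zero
      (x := fun j => algebraMap F K (x (i, s j))) ?_ Fin.val_injective (by simp) hv
    exact (algebraMap F K).injective.comp
      (x.injective.comp ((Prod.mk_right_injective i).comp hs))
  · have hfiber (i : Fin g) : Fintype.card {p : E // (p : Fin g × Fin r).1 = i} =
        (E.filter (fun p => p.1 = i)).card := by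
      rw [Fintype.card_subtype, ← Finset.card_map (Function.Embedding.subtype _)]
      congr 1
      ext p
      simp only [Finset.mem_map, Finset.mem_filter, Finset.mem_univ, true_and,
        Function.Embedding.coe_subtype, Subtype.exists, exists_and_right, exists_prop]
      grind
    have hindep := linearIndependent_vandermonde_moore_columns (K := K) (a := a) (c := c) (N := N)
      (fun p : E => (p : Fin g × Fin r).1)
      (x := fun p : E => x p) (x.injective.comp Subtype.val_injective) (by simpa using hE)
      ?_ (fun i => (hfiber i).symm ▸ hloc i) ?_
    · convert hindep using 3 with p
      · funext ik
        split_ifs with hik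
        · simp [hik]
        · rfl
      · rfl
    · rw [Fintype.card_coe, hE, hrank]
      omega
    · by_contra! hlt
      have hsum : E.card = ∑ i, (E.filter (fun p => p.1 = i)).card :=
        Finset.card_eq_sum_card_fiberwise fun _ _ => Finset.mem_univ _
      have hle : ∑ i : Fin g, ((E.filter (fun p => p.1 = i)).card + 1) ≤
          ∑ _i : Fin g, (a + c) :=
        Finset.sum_le_sum fun i _ => (hfiber i) ▸ hlt i
      rw [Finset.sum_add_distrib, ← hsum, hE] at hle
      simp only [Finset.sum_const, Finset.card_univ, Fintype.card_fin, smul_eq_mul, mul_one,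
        mul_add] at hle
      omega
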